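/- Let 0 < γ ≤ 1 with 1/γ a positive integer, let L > 0, and let Ω = [0, L/γ] × [0, L] be a periodic domain. Then for every smooth function φ : ℝ² → ℝ that is (L/γ)-periodic in x₁ and L-periodic in x₂ with mean value zero over Ω, one has ‖φ‖_∞² ≤ (1/(γπ)) · ‖φ‖ · ‖Δφ‖; that is, the Agmon constant c_AT(γ) on the torus of aspect ratio γ satisfies c_AT(γ) ≤ 1/√(γπ). -/

import Mathlib

open MeasureTheory Real

/-- First partial derivative of a function on `ℝ²`. -/
noncomputable def pd1 (f : ℝ × ℝ → ℝ) (p : ℝ × ℝ) : ℝ :=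
  deriv (fun s => f (s, p.2)) p.1

/-- Second partial derivative of a function on `ℝ²`. -/
noncomputable def pd2 (f : ℝ × ℝ → ℝ) (p : ℝ × ℝ) : ℝ :=
  deriv (fun s => f (p.1, s)) p.2

/-- The Laplacian `Δf = ∂₁²f + ∂₂²f`. -/
noncomputable def lap (f : ℝ × ℝ → ℝ) (p : ℝ × ℝ) : ℝ :=
  pd1 (pd1 f) p + pd2 (pd2 f) p

/-- A quarter-plane lattice count: at most `n` points `(a, b)` with `a ≥ 1`, `b ≥ 0` satisfy
`a ^ 2 + b ^ 2 ≤ n`. -/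
theorem card_le_of_sq_add_sq_le {n : ℕ} {F : Finset (ℕ × ℕ)}
    (hF : ∀ p ∈ F, 1 ≤ p.1 ∧ p.1 ^ 2 + p.2 ^ 2 ≤ n) : F.card ≤ n := by
  obtain ⟨r, j, hn, hj⟩ : ∃ r j : ℕ, n = r ^ 2 + j ∧ j ≤ 2 * r := by
    have h1 := Nat.sqrt_le' n
    have h2 := Nat.sqrt_le_add n
    exact ⟨n.sqrt, n - n.sqrt ^ 2, by omega, by rw [pow_two]; omega⟩
  rcases r with _ | r
  · have : F = ∅ := by
      refine Finset.eq_empty_of_forall_notMem fun p hp => ?_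
      have := hF p hp
      nlinarith
    simp [this]
  · have hsub : F ⊆ (Finset.Icc 1 r ×ˢ Finset.range (r + 2)) ∪
        ({r + 1} ×ˢ Finset.range (j + 1)) := by
      rintro ⟨a, b⟩ hp
      obtain ⟨h1, h2⟩ := hF _ hp
      dsimp only at h1 h2
      have ha : a < r + 2 := by nlinarith
      have hb : b < r + 2 := by nlinarith
      simp only [Finset.mem_union, Finset.mem_product, Finset.mem_Icc, Finset.mem_range,
        Finset.mem_singleton]
      by_cases har : a ≤ r
      · exact Or.inl ⟨⟨h1, har⟩, hb⟩
      · have : a = r + 1 := by omega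
        subst this
        refine Or.inr ⟨rfl, ?_⟩
        have : b ^ 2 ≤ j := by omega
        nlinarith
    calc F.card ≤ _ := Finset.card_le_card hsub
      _ ≤ _ := Finset.card_union_le _ _
      _ ≤ n := by
        simp only [Finset.card_product, Nat.card_Icc, Finset.card_range, Finset.card_singleton]
        subst hn
        simp only [Nat.add_sub_cancel]
        apply le_of_eq
        ring

theorem sum_antitone_sq_add_sq_le {f : ℕ → ℝ} (hf : Antitone f) (F : Finset (ℕ × ℕ))
    (hF : ∀ p ∈ F, 1 ≤ p.1) :
    ∑ p ∈ F, f (p.1 ^ 2 + p.2 ^ 2) ≤ ∑ n ∈ Finset.range F.card, f (n + 1) := by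
  induction hc : F.card generalizing F with
  | zero => simp [Finset.card_eq_zero.mp hc]
  | succ c ih =>
    obtain ⟨q, hq, hmax⟩ := F.exists_max_image (fun p => p.1 ^ 2 + p.2 ^ 2)
      (Finset.card_pos.mp (by omega))
    have hcard : F.card ≤ q.1 ^ 2 + q.2 ^ 2 :=
      card_le_of_sq_add_sq_le fun p hp => ⟨hF p hp, hmax p hp⟩
    rw [← Finset.sum_erase_add _ _ hq, Finset.sum_range_succ]
    refine add_le_add (ih _ (fun p hp => hF p (Finset.mem_of_mem_erase hp)) ?_) (hf (by omega))
    rw [Finset.card_erase_of_mem hq, hc, Nat.add_sub_cancel]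

theorem div_one_add_sq_le_arctan_sub {μ : ℝ} (hμ : 0 < μ) (n : ℕ) :
    μ / (1 + μ ^ 2 * ((n + 1 : ℕ) : ℝ) ^ 2) ≤
      arctan (μ * ((n + 1 : ℕ) : ℝ)) - arctan (μ * (n : ℝ)) := by
  have hlt : μ * (n : ℝ) < μ * ((n + 1 : ℕ) : ℝ) := by push_cast; nlinarith
  obtain ⟨c, hc, hder⟩ := exists_hasDerivAt_eq_slope arctan (fun x => 1 / (1 + x ^ 2)) hlt
    continuous_arctan.continuousOn fun x _ => hasDerivAt_arctan x
  have hdiff : μ * ((n + 1 : ℕ) : ℝ) - μ * (n : ℝ) = μ := by push_cast; ring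
  rw [hdiff, eq_div_iff hμ.ne'] at hder
  rw [← hder, one_div_mul_eq_div]
  have h0 : 0 ≤ c := le_trans (by positivity) hc.1.le
  have : c ^ 2 ≤ μ ^ 2 * ((n + 1 : ℕ) : ℝ) ^ 2 := by
    rw [← mul_pow]; exact pow_le_pow_left₀ h0 hc.2.le 2
  gcongr

theorem antitone_div_one_add_sq {μ : ℝ} (hμ : 0 < μ) :
    Antitone fun n : ℕ => μ / (1 + μ ^ 2 * (n : ℝ) ^ 2) := by
  intro a b hab
  dsimp only
  gcongr

theorem sum_quadrant_le {μ : ℝ} (hμ : 0 < μ) (F : Finset (ℕ × ℕ)) (hF : ∀ p ∈ F, 1 ≤ p.1) :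
    ∑ p ∈ F, μ / (1 + μ ^ 2 * ((p.1 ^ 2 + p.2 ^ 2 : ℕ) : ℝ) ^ 2) ≤ π / 2 := by
  refine (sum_antitone_sq_add_sq_le (antitone_div_one_add_sq hμ) F hF).trans ?_
  refine (Finset.sum_le_sum fun n _ => div_one_add_sq_le_arctan_sub hμ n).trans ?_
  rw [Finset.sum_range_sub fun n : ℕ => arctan (μ * (n : ℝ))]
  simpa using (arctan_lt_pi_div_two _).le

theorem sum_of_injOn_le {μ : ℝ} (hμ : 0 < μ) (F : Finset (Fin 2 → ℤ)) (e : (Fin 2 → ℤ) → ℕ × ℕ)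
    (hinj : Set.InjOn e F) (hpos : ∀ k ∈ F, 1 ≤ (e k).1)
    (hsq : ∀ k, (((e k).1 ^ 2 + (e k).2 ^ 2 : ℕ) : ℝ) = (k 0 : ℝ) ^ 2 + (k 1 : ℝ) ^ 2) :
    ∑ k ∈ F, μ / (1 + μ ^ 2 * ((k 0 : ℝ) ^ 2 + (k 1 : ℝ) ^ 2) ^ 2) ≤ π / 2 := by
  have h := sum_quadrant_le hμ (F.image e) (by simpa using hpos)
  rw [Finset.sum_image hinj] at h
  simpa only [hsq] using h

/-- The lattice sum `∑_{k ≠ 0} μ / (1 + μ² |k|⁴)` over `ℤ²` is at most `2 π`. -/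
theorem sum_lattice_le {μ : ℝ} (hμ : 0 < μ) (F : Finset (Fin 2 → ℤ)) (hF : 0 ∉ F) :
    ∑ k ∈ F, μ / (1 + μ ^ 2 * ((k 0 : ℝ) ^ 2 + (k 1 : ℝ) ^ 2) ^ 2) ≤ 2 * π := by
  classical
  set w : (Fin 2 → ℤ) → ℝ :=
    fun k => μ / (1 + μ ^ 2 * ((k 0 : ℝ) ^ 2 + (k 1 : ℝ) ^ 2) ^ 2) with hw
  have hw0 : ∀ k, 0 ≤ w k := fun k => by positivity
  have habs : ∀ z : ℤ, ((z.natAbs : ℕ) : ℝ) ^ 2 = (z : ℝ) ^ 2 := fun z => by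
    rw [Nat.cast_natAbs, Int.cast_abs, sq_abs]
  let Q : Fin 4 → (Fin 2 → ℤ) → Prop := ![fun k => 1 ≤ k 0 ∧ 0 ≤ k 1,
    fun k => 1 ≤ k 1 ∧ k 0 ≤ 0, fun k => k 0 ≤ -1 ∧ k 1 ≤ 0, fun k => k 1 ≤ -1 ∧ 0 ≤ k 0]
  have hcover : ∀ k ∈ F, ∃ i, Q i k := by
    intro k hk
    have hne : ¬ (k 0 = 0 ∧ k 1 = 0) := by
      rintro ⟨h0, h1⟩
      apply hF
      convert hk
      ext i
      fin_cases i <;> simp [h0, h1]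
    simp [Fin.exists_fin_succ, Q]
    omega
  have hext : ∀ {k l : Fin 2 → ℤ}, k 0 = l 0 → k 1 = l 1 → k = l := fun h0 h1 => by
    ext i; fin_cases i <;> assumption
  have hsq₁ : ∀ k : Fin 2 → ℤ,
      (((k 0).natAbs ^ 2 + (k 1).natAbs ^ 2 : ℕ) : ℝ) = (k 0 : ℝ) ^ 2 + (k 1 : ℝ) ^ 2 :=
    fun k => by rw [Nat.cast_add, Nat.cast_pow, Nat.cast_pow, habs, habs]
  have hsq₂ : ∀ k : Fin 2 → ℤ,
      (((k 1).natAbs ^ 2 + (k 0).natAbs ^ 2 : ℕ) : ℝ) = (k 0 : ℝ) ^ 2 + (k 1 : ℝ) ^ 2 :=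
    fun k => by rw [add_comm, hsq₁]
  have hQ : ∀ i, ∑ k ∈ F with Q i k, w k ≤ π / 2 := by
    intro i
    fin_cases i
    on_goal 1 => refine sum_of_injOn_le hμ _ (fun k => ((k 0).natAbs, (k 1).natAbs)) ?_ ?_ hsq₁
    on_goal 3 => refine sum_of_injOn_le hμ _ (fun k => ((k 1).natAbs, (k 0).natAbs)) ?_ ?_ hsq₂
    on_goal 5 => refine sum_of_injOn_le hμ _ (fun k => ((k 0).natAbs, (k 1).natAbs)) ?_ ?_ hsq₁
    on_goal 7 => refine sum_of_injOn_le hμ _ (fun k => ((k 1).natAbs, (k 0).natAbs)) ?_ ?_ hsq₂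
    all_goals
      intro k hk
      simp [Q] at hk
      first
      | dsimp only
        omega
      | intro l hl h
        simp [Q] at hl h
        exact hext (by omega) (by omega)
  calc ∑ k ∈ F, w k ≤ ∑ k ∈ F, ∑ i, if Q i k then w k else 0 := by
        refine Finset.sum_le_sum fun k hk => ?_
        obtain ⟨i, hi⟩ := hcover k hk
        calc w k = if Q i k then w k else 0 := (if_pos hi).symm
          _ ≤ _ := Finset.single_le_sum (f := fun i => if Q i k then w k else 0)
            (fun j _ => by split_ifs <;> simp [hw0]) (Finset.mem_univ i)
    _ = ∑ i, ∑ k ∈ F with Q i k, w k := by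
        rw [Finset.sum_comm]
        exact Finset.sum_congr rfl fun i _ => (Finset.sum_filter _ _).symm
    _ ≤ ∑ _i : Fin 4, π / 2 := Finset.sum_le_sum fun i _ => hQ i
    _ = 2 * π := by simp; ring

theorem le_two_mul_sqrt_of_forall_le {X C A B : ℝ} (hC : 0 ≤ C) (hA : 0 ≤ A) (hB : 0 ≤ B)
    (h : ∀ μ : ℝ, 0 < μ → X ≤ C * (A / μ + μ * B)) : X ≤ 2 * C * (√A * √B) := by
  have key : ∀ ε : ℝ, 0 < ε → X ≤ 2 * C * (√(A + ε) * √(B + ε)) := by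
    intro ε hε
    have ha : 0 < √(A + ε) := by positivity
    have hb : 0 < √(B + ε) := by positivity
    refine (h (√(A + ε) / √(B + ε)) (by positivity)).trans ?_
    have h1 : A / (√(A + ε) / √(B + ε)) ≤ √(A + ε) * √(B + ε) := by
      rw [div_div_eq_mul_div, div_le_iff₀ ha, mul_right_comm, mul_self_sqrt (by positivity)]
      nlinarith
    have h2 : √(A + ε) / √(B + ε) * B ≤ √(A + ε) * √(B + ε) := by
      rw [div_mul_eq_mul_div, div_le_iff₀ hb, mul_assoc, mul_self_sqrt (by positivity)]
      nlinarith
    nlinarith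
  have hcont : Continuous fun ε : ℝ => 2 * C * (√(A + ε) * √(B + ε)) := by fun_prop
  have hlim := (hcont.tendsto 0).mono_left (nhdsWithin_le_nhds (s := Set.Ioi 0))
  simp only [add_zero] at hlim
  exact ge_of_tendsto hlim (by filter_upwards [self_mem_nhdsWithin] with ε hε using key ε hε)

/-- Agmon-type bound for sequences on `ℤ²`. -/
theorem sum_sq_le_of_lattice {a lam : (Fin 2 → ℤ) → ℝ} {A B : ℝ}
    (hlam : ∀ k, (k 0 : ℝ) ^ 2 + (k 1 : ℝ) ^ 2 ≤ lam k)
    (F : Finset (Fin 2 → ℤ)) (hF : 0 ∉ F)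
    (hA : ∑ k ∈ F, a k ^ 2 ≤ A) (hB : ∑ k ∈ F, (lam k * a k) ^ 2 ≤ B) :
    (∑ k ∈ F, a k) ^ 2 ≤ 4 * π * (√A * √B) := by
  have hA0 : 0 ≤ A := (Finset.sum_nonneg fun k _ => sq_nonneg _).trans hA
  have hB0 : 0 ≤ B := (Finset.sum_nonneg fun k _ => sq_nonneg _).trans hB
  have : ∀ μ : ℝ, 0 < μ → (∑ k ∈ F, a k) ^ 2 ≤ 2 * π * (A / μ + μ * B) := by
    intro μ hμ
    refine (Finset.sum_sq_le_sum_mul_sum_of_sq_le_mul F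
      (f := fun k => μ / (1 + μ ^ 2 * lam k ^ 2))
      (g := fun k => a k ^ 2 / μ + μ * (lam k * a k) ^ 2) (fun k _ => by positivity)
      (fun k _ => by positivity) (fun k _ => ?_)).trans ?_
    · have : 0 < 1 + μ ^ 2 * lam k ^ 2 := by positivity
      apply le_of_eq
      field_simp
    · refine mul_le_mul ?_ ?_ (Finset.sum_nonneg fun k _ => by positivity) (by positivity)
      · refine (Finset.sum_le_sum fun k _ => ?_).trans (sum_lattice_le hμ F hF)
        gcongr
        exact hlam k
      · rw [Finset.sum_add_distrib, ← Finset.sum_div, ← Finset.mul_sum]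
        gcongr
  refine (le_two_mul_sqrt_of_forall_le (by positivity) hA0 hB0 this).trans_eq ?_
  ring

/-- A continuous function on `ℝ²` that is `1`-periodic in each variable descends to the torus. -/
theorem exists_continuousMap_unitAddTorus {g : ℝ × ℝ → ℂ} (hg : Continuous g)
    (h1 : ∀ x y, g (x + 1, y) = g (x, y)) (h2 : ∀ x y, g (x, y + 1) = g (x, y)) :
    ∃ F : C(UnitAddTorus (Fin 2), ℂ), ∀ x : Fin 2 → ℝ, F (fun i => (x i : UnitAddCircle)) =
      g (x 0, x 1) := by
  let q : C(Fin 2 → ℝ, UnitAddTorus (Fin 2)) :=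
    ⟨fun a i => (a i : UnitAddCircle),
      continuous_pi fun i => (AddCircle.continuous_mk' 1).comp (continuous_apply i)⟩
  have hq : Topology.IsQuotientMap q :=
    (IsOpenQuotientMap.piMap fun _ => QuotientAddGroup.isOpenQuotientMap_mk).isQuotientMap
  let G : C(Fin 2 → ℝ, ℂ) := ⟨fun a => g (a 0, a 1), by fun_prop⟩
  have hdesc : ∀ a b, q a = q b → G a = G b := by
    intro a b hab
    have h : ∀ i, (a i : UnitAddCircle) = b i := fun i => congrFun hab i
    have hp1 : ∀ y, Function.Periodic (fun x => g (x, y)) 1 := fun y x => h1 x y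
    have hp2 : ∀ x, Function.Periodic (fun y => g (x, y)) 1 := fun x y => h2 x y
    calc g (a 0, a 1) = (hp1 (a 1)).lift (a 0 : UnitAddCircle) := rfl
      _ = (hp1 (a 1)).lift (b 0 : UnitAddCircle) := by rw [h 0]
      _ = (hp2 (b 0)).lift (a 1 : UnitAddCircle) := rfl
      _ = (hp2 (b 0)).lift (b 1 : UnitAddCircle) := by rw [h 1]
  exact ⟨hq.lift G hdesc, fun x => DFunLike.congr_fun (hq.lift_comp G hdesc) x⟩

theorem setIntegral_rectangle {E : Type*} [NormedAddCommGroup E] [NormedSpace ℝ E]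
    {f : ℝ × ℝ → E} (hf : Continuous f) {P L : ℝ} (hP : 0 ≤ P) (hL : 0 ≤ L) :
    ∫ p in Set.Icc (0 : ℝ) P ×ˢ Set.Icc (0 : ℝ) L, f p =
      ∫ x in 0..P, ∫ y in 0..L, f (x, y) := by
  rw [Measure.volume_eq_prod, setIntegral_prod, intervalIntegral.integral_of_le hP,
    ← integral_Icc_eq_integral_Ioc]
  · refine setIntegral_congr_fun measurableSet_Icc fun x _ => ?_
    rw [intervalIntegral.integral_of_le hL, ← integral_Icc_eq_integral_Ioc]
  · exact hf.continuousOn.integrableOn_compact (isCompact_Icc.prod isCompact_Icc)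

theorem intervalIntegral_swap {E : Type*} [NormedAddCommGroup E] [NormedSpace ℝ E]
    {f : ℝ × ℝ → E} (hf : Continuous f) {P L : ℝ} (hP : 0 ≤ P) (hL : 0 ≤ L) :
    ∫ x in 0..P, ∫ y in 0..L, f (x, y) = ∫ y in 0..L, ∫ x in 0..P, f (x, y) := by
  rw [← setIntegral_rectangle hf hP hL,
    ← setIntegral_rectangle (f := fun q : ℝ × ℝ => f (q.2, q.1)) (by fun_prop) hL hP,
    Measure.volume_eq_prod, ← setIntegral_prod_swap]
  rfl

theorem intervalIntegral_rescale {E : Type*} [NormedAddCommGroup E] [NormedSpace ℝ E]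
    (f : ℝ × ℝ → E) {P L : ℝ} (hP : 0 < P) (hL : 0 < L) :
    ∫ x in (0 : ℝ)..1, ∫ y in (0 : ℝ)..1, f (P * x, L * y) =
      (P * L)⁻¹ • ∫ x in 0..P, ∫ y in 0..L, f (x, y) := by
  have h : ∀ x, ∫ y in (0 : ℝ)..1, f (P * x, L * y) = L⁻¹ • ∫ y in 0..L, f (P * x, y) := by
    intro x
    simp [intervalIntegral.integral_comp_mul_left (fun y => f (P * x, y)) hL.ne']
  simp only [h, intervalIntegral.integral_smul]
  rw [intervalIntegral.integral_comp_mul_left (fun x => ∫ y in 0..L, f (x, y)) hP.ne']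
  simp [smul_smul, mul_comm]

theorem setIntegral_cube {E : Type*} [NormedAddCommGroup E] [NormedSpace ℝ E]
    {f : ℝ × ℝ → E} (hf : Continuous f) :
    ∫ x : Fin 2 → ℝ in {x : Fin 2 → ℝ | ∀ i, x i ∈ Set.Ioc (0 : ℝ) (0 + 1)}, f (x 0, x 1) =
      ∫ x in (0 : ℝ)..1, ∫ y in (0 : ℝ)..1, f (x, y) := by
  have hset : {x : Fin 2 → ℝ | ∀ i, x i ∈ Set.Ioc (0 : ℝ) (0 + 1)} =
      MeasurableEquiv.finTwoArrow (α := ℝ) ⁻¹' (Set.Ioc (0 : ℝ) 1 ×ˢ Set.Ioc (0 : ℝ) 1) := by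
    ext x
    simp [MeasurableEquiv.finTwoArrow, Fin.forall_fin_two]
  rw [hset]
  have h := (volume_preserving_finTwoArrow ℝ).setIntegral_preimage_emb
    (MeasurableEquiv.finTwoArrow (α := ℝ)).measurableEmbedding f
    (Set.Ioc (0 : ℝ) 1 ×ˢ Set.Ioc (0 : ℝ) 1)
  refine Eq.trans ?_ (h.trans ?_)
  · rfl
  · rw [Measure.volume_eq_prod, setIntegral_prod, intervalIntegral.integral_of_le zero_le_one]
    · simp only [intervalIntegral.integral_of_le zero_le_one]
    · exact (hf.continuousOn.integrableOn_compact (isCompact_Icc.prod isCompact_Icc)).mono_set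
        (Set.prod_mono Set.Ioc_subset_Icc_self Set.Ioc_subset_Icc_self)

section Torus

open UnitAddTorus

/-- The normalised Haar measure on `ℝ / ℤ`, as used in the theory of multiple Fourier series. -/
noncomputable local instance : MeasureSpace UnitAddCircle := ⟨AddCircle.haarAddCircle⟩

local instance : Measure.IsAddHaarMeasure (volume : Measure UnitAddCircle) :=
  inferInstanceAs (Measure.IsAddHaarMeasure AddCircle.haarAddCircle)

local instance : IsProbabilityMeasure (volume : Measure UnitAddCircle) :=
  inferInstanceAs (IsProbabilityMeasure AddCircle.haarAddCircle)

theorem hasSum_sq_mFourierCoeff_continuousMap (F : C(UnitAddTorus (Fin 2), ℂ)) :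
    HasSum (fun k => ‖mFourierCoeff F k‖ ^ 2)
      (∫ x : Fin 2 → ℝ in {x : Fin 2 → ℝ | ∀ i, x i ∈ Set.Ioc (0 : ℝ) (0 + 1)},
        ‖F fun i => (x i : UnitAddCircle)‖ ^ 2) := by
  have h := hasSum_sq_mFourierCoeff (F.toLp 2 volume ℂ)
  simp only [mFourierCoeff_toLp] at h
  rw [← integral_preimage (fun x => ‖F x‖ ^ 2) fun _ => 0]
  convert h using 1
  refine integral_congr_ae ?_
  filter_upwards [ContinuousMap.coeFn_toLp (𝕜 := ℂ) (p := 2) volume F] with x hx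
  rw [hx]

end Torus

/-- The conjugated character `exp (-2πikx / T)` of frequency `k` and period `T`. -/
noncomputable def character (T : ℝ) (k : ℤ) (x : ℝ) : ℂ :=
  Complex.exp (-(2 * π * Complex.I * k / T) * x)

theorem continuous_character (T : ℝ) (k : ℤ) : Continuous (character T k) := by
  unfold character; fun_prop

/-- Unnormalised Fourier coefficient on the rectangle `[0, P] × [0, L]`. -/
noncomputable def rectCoeff (P L : ℝ) (k : Fin 2 → ℤ) (f : ℝ × ℝ → ℝ) : ℂ :=
  ∫ x in 0..P, ∫ y in 0..L, character P (k 0) x * character L (k 1) y * (f (x, y) : ℂ)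

theorem fourier_neg_coe_eq_character {T : ℝ} (hT : T ≠ 0) (k : ℤ) (x : ℝ) :
    fourier (-k) (x : UnitAddCircle) = character T k (T * x) := by
  rw [fourier_coe_apply, character]
  congr 1
  have : (T : ℂ) ≠ 0 := by exact_mod_cast hT
  push_cast
  field_simp

/-- Fourier data of a doubly periodic function on a rectangle: Parseval's identity, and absolute
convergence of the Fourier series to the function. -/
theorem rectCoeff_properties {P L : ℝ} (hP : 0 < P) (hL : 0 < L) {f : ℝ × ℝ → ℝ}
    (hf : Continuous f) (h1 : ∀ x y, f (x + P, y) = f (x, y))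
    (h2 : ∀ x y, f (x, y + L) = f (x, y)) :
    HasSum (fun k => ‖(P * L)⁻¹ • rectCoeff P L k f‖ ^ 2)
      ((P * L)⁻¹ * ∫ x in 0..P, ∫ y in 0..L, f (x, y) ^ 2) ∧
    (Summable (fun k => ‖(P * L)⁻¹ • rectCoeff P L k f‖) →
      ∀ p, |f p| ≤ ∑' k, ‖(P * L)⁻¹ • rectCoeff P L k f‖) := by
  obtain ⟨F, hF⟩ := exists_continuousMap_unitAddTorus
    (g := fun p => (f (P * p.1, L * p.2) : ℂ)) (by fun_prop)
    (fun x y => by simp only [mul_add, mul_one, h1]) (fun x y => by simp only [mul_add, mul_one, h2])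
  have hcoeff : ∀ k, UnitAddTorus.mFourierCoeff F k = (P * L)⁻¹ • rectCoeff P L k f := by
    intro k
    rw [UnitAddTorus.mFourierCoeff_eq_integral F k fun _ => 0, rectCoeff,
      ← intervalIntegral_rescale
        (fun p => character P (k 0) p.1 * character L (k 1) p.2 * (f p : ℂ)) hP hL]
    have hcP := continuous_character P (k 0)
    have hcL := continuous_character L (k 1)
    rw [← setIntegral_cube (f := fun p => character P (k 0) (P * p.1) *
      character L (k 1) (L * p.2) * (f (P * p.1, L * p.2) : ℂ)) (by fun_prop)]
    congr 1
    ext x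
    rw [hF, smul_eq_mul]
    simp only [UnitAddTorus.mFourier, ContinuousMap.coe_mk, Fin.prod_univ_two, Pi.neg_apply]
    rw [fourier_neg_coe_eq_character hP.ne', fourier_neg_coe_eq_character hL.ne']
  constructor
  · have h := hasSum_sq_mFourierCoeff_continuousMap F
    simp only [hcoeff, hF, Complex.norm_real, Real.norm_eq_abs, sq_abs] at h
    rw [setIntegral_cube (f := fun p => f (P * p.1, L * p.2) ^ 2) (by fun_prop),
      intervalIntegral_rescale (fun p => f p ^ 2) hP hL] at h
    exact h
  · intro hs p
    have hs' : Summable (UnitAddTorus.mFourierCoeff F) := by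
      refine Summable.of_norm ?_
      simpa only [hcoeff] using hs
    have h := UnitAddTorus.hasSum_mFourier_series_apply_of_summable hs'
      (fun i => ((![p.1 / P, p.2 / L] i : ℝ) : UnitAddCircle))
    rw [hF] at h
    have hnorm : |f p| = ‖((f (P * (p.1 / P), L * (p.2 / L)) : ℝ) : ℂ)‖ := by
      rw [mul_div_cancel₀ _ hP.ne', mul_div_cancel₀ _ hL.ne', Complex.norm_real,
        Real.norm_eq_abs]
    have hle : ∀ k, ‖UnitAddTorus.mFourierCoeff F k • UnitAddTorus.mFourier k
        (fun i => ((![p.1 / P, p.2 / L] i : ℝ) : UnitAddCircle))‖ ≤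
        ‖(P * L)⁻¹ • rectCoeff P L k f‖ := by
      intro k
      rw [← hcoeff, norm_smul]
      refine mul_le_of_le_one_right (norm_nonneg _) ?_
      exact (ContinuousMap.norm_coe_le_norm _ _).trans_eq UnitAddTorus.mFourier_norm
    rw [hnorm]
    have h' := h.tsum_eq
    simp only [Matrix.cons_val_zero, Matrix.cons_val_one] at h'
    rw [← h']
    exact tsum_of_norm_bounded hs.hasSum hle

theorem integral_character_mul_deriv {T : ℝ} (hT : T ≠ 0) (k : ℤ) {h h' : ℝ → ℝ}
    (hh : ∀ x, HasDerivAt h (h' x) x) (hc : Continuous h') (hper : h T = h 0) :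
    ∫ x in 0..T, character T k x * (h' x : ℂ) =
      (2 * π * Complex.I * k / T) * ∫ x in 0..T, character T k x * (h x : ℂ) := by
  set c : ℂ := 2 * π * Complex.I * k / T with hcdef
  have hχ : ∀ x, HasDerivAt (character T k) (-c * character T k x) x := by
    intro x
    have h1 : HasDerivAt (fun x : ℝ => -c * (x : ℂ)) (-c) x := by
      simpa using (Complex.ofRealCLM.hasDerivAt (x := x)).const_mul (-c)
    exact (mul_comm _ _).subst (motive := fun d => HasDerivAt (character T k) d x) h1.cexp
  have hχT : character T k T = character T k 0 := by
    have hT' : (T : ℂ) ≠ 0 := by exact_mod_cast hT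
    rw [character, character, div_eq_mul_inv]
    simp only [neg_mul, Complex.ofReal_zero, mul_zero, Complex.exp_zero]
    rw [mul_assoc _ (T : ℂ)⁻¹, inv_mul_cancel₀ hT', Complex.exp_eq_one_iff]
    exact ⟨-k, by push_cast; ring⟩
  have hcont := continuous_character T k
  rw [intervalIntegral.integral_mul_deriv_eq_deriv_mul (fun x _ => hχ x)
    (fun x _ => (hh x).ofReal_comp) (Continuous.intervalIntegrable (by fun_prop) _ _)
    (Continuous.intervalIntegrable (by fun_prop) _ _)]
  rw [hχT, hper, sub_self, zero_sub, ← intervalIntegral.integral_neg,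
    ← intervalIntegral.integral_const_mul]
  congr 1
  ext x
  ring

theorem integral_character_mul_deriv_deriv {T : ℝ} (hT : T ≠ 0) (k : ℤ) {h h' h'' : ℝ → ℝ}
    (hh : ∀ x, HasDerivAt h (h' x) x) (hh' : ∀ x, HasDerivAt h' (h'' x) x) (hc : Continuous h'')
    (hper : h T = h 0) (hper' : h' T = h' 0) :
    ∫ x in 0..T, character T k x * (h'' x : ℂ) =
      ((-(2 * π * k / T) ^ 2 : ℝ) : ℂ) * ∫ x in 0..T, character T k x * (h x : ℂ) := by
  have hc' : Continuous h' := continuous_iff_continuousAt.mpr fun x => (hh' x).continuousAt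
  rw [integral_character_mul_deriv hT k hh' hc hper', integral_character_mul_deriv hT k hh hc' hper,
    ← mul_assoc]
  congr 1
  push_cast
  linear_combination (2 * π * k / T : ℂ) ^ 2 * Complex.I_sq

theorem hasDerivAt_pd1 {f : ℝ × ℝ → ℝ} (hf : ContDiff ℝ (⊤ : ℕ∞) f) (x y : ℝ) :
    HasDerivAt (fun s => f (s, y)) (pd1 f (x, y)) x := by
  have hf' : Differentiable ℝ f := hf.differentiable (by simp)
  exact DifferentiableAt.hasDerivAt (by fun_prop)

theorem hasDerivAt_pd2 {f : ℝ × ℝ → ℝ} (hf : ContDiff ℝ (⊤ : ℕ∞) f) (x y : ℝ) :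
    HasDerivAt (fun s => f (x, s)) (pd2 f (x, y)) y := by
  have hf' : Differentiable ℝ f := hf.differentiable (by simp)
  exact DifferentiableAt.hasDerivAt (by fun_prop)

theorem contDiff_pd1 {f : ℝ × ℝ → ℝ} (hf : ContDiff ℝ (⊤ : ℕ∞) f) :
    ContDiff ℝ (⊤ : ℕ∞) (pd1 f) := by
  have h : pd1 f = fun p => fderiv ℝ f p (1, 0) := by
    ext ⟨x, y⟩
    refine (hasDerivAt_pd1 hf x y).unique ?_
    exact ((hf.differentiable (by simp)) (x, y)).hasFDerivAt.comp_hasDerivAt x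
      ((hasDerivAt_id x).prodMk (hasDerivAt_const x y))
  rw [h]
  exact (hf.fderiv_right (m := (⊤ : ℕ∞)) (by simp)).clm_apply contDiff_const

theorem contDiff_pd2 {f : ℝ × ℝ → ℝ} (hf : ContDiff ℝ (⊤ : ℕ∞) f) :
    ContDiff ℝ (⊤ : ℕ∞) (pd2 f) := by
  have h : pd2 f = fun p => fderiv ℝ f p (0, 1) := by
    ext ⟨x, y⟩
    refine (hasDerivAt_pd2 hf x y).unique ?_
    exact ((hf.differentiable (by simp)) (x, y)).hasFDerivAt.comp_hasDerivAt y
      ((hasDerivAt_const y x).prodMk (hasDerivAt_id y))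
  rw [h]
  exact (hf.fderiv_right (m := (⊤ : ℕ∞)) (by simp)).clm_apply contDiff_const

theorem pd1_add_period {f : ℝ × ℝ → ℝ} {a b : ℝ} (h : ∀ x y, f (x + a, y + b) = f (x, y))
    (x y : ℝ) : pd1 f (x + a, y + b) = pd1 f (x, y) := by
  simp only [pd1]
  rw [← deriv_comp_add_const]
  simp only [h]

theorem pd2_add_period {f : ℝ × ℝ → ℝ} {a b : ℝ} (h : ∀ x y, f (x + a, y + b) = f (x, y))
    (x y : ℝ) : pd2 f (x + a, y + b) = pd2 f (x, y) := by
  simp only [pd2]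
  rw [← deriv_comp_add_const]
  simp only [h]

theorem lap_add_period {f : ℝ × ℝ → ℝ} {a b : ℝ} (h : ∀ x y, f (x + a, y + b) = f (x, y))
    (x y : ℝ) : lap f (x + a, y + b) = lap f (x, y) := by
  simp only [lap, pd1_add_period (pd1_add_period h), pd2_add_period (pd2_add_period h)]

theorem continuous_lap {f : ℝ × ℝ → ℝ} (hf : ContDiff ℝ (⊤ : ℕ∞) f) : Continuous (lap f) :=
  (contDiff_pd1 (contDiff_pd1 hf)).continuous.add (contDiff_pd2 (contDiff_pd2 hf)).continuous

section Coefficients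

variable {P L : ℝ} {f : ℝ × ℝ → ℝ}

theorem rectCoeff_add (k : Fin 2 → ℤ) {g : ℝ × ℝ → ℝ} (hP : 0 ≤ P) (hL : 0 ≤ L)
    (hf : Continuous f) (hg : Continuous g) :
    rectCoeff P L k (fun p => f p + g p) = rectCoeff P L k f + rectCoeff P L k g := by
  have hcP := continuous_character P (k 0)
  have hcL := continuous_character L (k 1)
  have hF : ∀ h : ℝ × ℝ → ℝ, Continuous h → Continuous fun p : ℝ × ℝ =>
    character P (k 0) p.1 * character L (k 1) p.2 * (h p : ℂ) := fun h hh => by fun_prop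
  have hint : ∀ h : ℝ × ℝ → ℝ, Continuous h → IntegrableOn (fun p : ℝ × ℝ =>
    character P (k 0) p.1 * character L (k 1) p.2 * (h p : ℂ))
    (Set.Icc (0 : ℝ) P ×ˢ Set.Icc (0 : ℝ) L) := fun h hh =>
      (hF h hh).continuousOn.integrableOn_compact (isCompact_Icc.prod isCompact_Icc)
  have hrect : ∀ h : ℝ × ℝ → ℝ, Continuous h → rectCoeff P L k h =
      ∫ p in Set.Icc (0 : ℝ) P ×ˢ Set.Icc (0 : ℝ) L,
        character P (k 0) p.1 * character L (k 1) p.2 * (h p : ℂ) := fun h hh =>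
    (setIntegral_rectangle (hF h hh) hP hL).symm
  rw [hrect (fun p => f p + g p) (hf.add hg), hrect f hf, hrect g hg, ← integral_add (hint f hf) (hint g hg)]
  congr 1
  ext p
  push_cast
  ring

theorem rectCoeff_pd2_pd2 (k : Fin 2 → ℤ) (hL : 0 < L) (hf : ContDiff ℝ (⊤ : ℕ∞) f)
    (h2 : ∀ x y, f (x, y + L) = f (x, y)) :
    rectCoeff P L k (pd2 (pd2 f)) = ((-(2 * π * k 1 / L) ^ 2 : ℝ) : ℂ) * rectCoeff P L k f := by
  have hper : ∀ x y, pd2 f (x, y + L) = pd2 f (x, y) := fun x y => by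
    simpa using pd2_add_period (a := 0) (b := L) (by simpa using h2) x y
  have hcont : Continuous (pd2 (pd2 f)) := (contDiff_pd2 (contDiff_pd2 hf)).continuous
  rw [rectCoeff, rectCoeff, ← intervalIntegral.integral_const_mul]
  congr 1
  ext x
  simp only [mul_assoc (character P (k 0) x), intervalIntegral.integral_const_mul]
  rw [integral_character_mul_deriv_deriv hL.ne' (k 1) (h := fun y => f (x, y))
    (fun y => hasDerivAt_pd2 hf x y) (fun y => hasDerivAt_pd2 (contDiff_pd2 hf) x y)
    (by fun_prop) (by simpa using h2 x 0) (by simpa using hper x 0)]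
  ring

theorem rectCoeff_pd1_pd1 (k : Fin 2 → ℤ) (hP : 0 < P) (hL : 0 ≤ L)
    (hf : ContDiff ℝ (⊤ : ℕ∞) f) (h1 : ∀ x y, f (x + P, y) = f (x, y)) :
    rectCoeff P L k (pd1 (pd1 f)) = ((-(2 * π * k 0 / P) ^ 2 : ℝ) : ℂ) * rectCoeff P L k f := by
  have hper : ∀ x y, pd1 f (x + P, y) = pd1 f (x, y) := fun x y => by
    simpa using pd1_add_period (a := P) (b := 0) (by simpa using h1) x y
  have hcont : Continuous (pd1 (pd1 f)) := (contDiff_pd1 (contDiff_pd1 hf)).continuous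
  have hcf : Continuous f := hf.continuous
  have hcP := continuous_character P (k 0)
  have hcL := continuous_character L (k 1)
  have hswap : ∀ h : ℝ × ℝ → ℝ, Continuous h → rectCoeff P L k h =
      ∫ y in 0..L, character L (k 1) y * ∫ x in 0..P, character P (k 0) x * (h (x, y) : ℂ) := by
    intro h hh
    rw [rectCoeff, intervalIntegral_swap (f := fun p : ℝ × ℝ =>
      character P (k 0) p.1 * character L (k 1) p.2 * (h p : ℂ)) (by fun_prop) hP.le hL]
    congr 1
    ext y
    rw [← intervalIntegral.integral_const_mul]
    congr 1
    ext x
    ring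
  rw [hswap _ hcont, hswap _ hcf, ← intervalIntegral.integral_const_mul]
  congr 1
  ext y
  rw [integral_character_mul_deriv_deriv hP.ne' (k 0) (h := fun x => f (x, y))
    (fun x => hasDerivAt_pd1 hf x y) (fun x => hasDerivAt_pd1 (contDiff_pd1 hf) x y)
    (by fun_prop) (by simpa using h1 0 y) (by simpa using hper 0 y)]
  ring

theorem rectCoeff_lap (k : Fin 2 → ℤ) (hP : 0 < P) (hL : 0 < L) (hf : ContDiff ℝ (⊤ : ℕ∞) f)
    (h1 : ∀ x y, f (x + P, y) = f (x, y)) (h2 : ∀ x y, f (x, y + L) = f (x, y)) :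
    rectCoeff P L k (lap f) =
      ((-((2 * π / P) ^ 2 * ((k 0 : ℝ) ^ 2 + (P / L) ^ 2 * (k 1 : ℝ) ^ 2)) : ℝ) : ℂ) *
        rectCoeff P L k f := by
  have h : lap f = fun p => pd1 (pd1 f) p + pd2 (pd2 f) p := rfl
  rw [h, rectCoeff_add k hP.le hL.le (contDiff_pd1 (contDiff_pd1 hf)).continuous
    (contDiff_pd2 (contDiff_pd2 hf)).continuous, rectCoeff_pd1_pd1 k hP hL.le hf h1,
    rectCoeff_pd2_pd2 k hL hf h2, ← add_mul, ← Complex.ofReal_add]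
  congr 2
  field_simp
  ring

end Coefficients

theorem rectCoeff_zero {P L : ℝ} (hP : 0 ≤ P) (hL : 0 ≤ L) {f : ℝ × ℝ → ℝ} (hf : Continuous f)
    (hmean : ∫ p in Set.Icc (0 : ℝ) P ×ˢ Set.Icc (0 : ℝ) L, f p = 0) :
    rectCoeff P L 0 f = 0 := by
  rw [setIntegral_rectangle hf hP hL] at hmean
  simp [rectCoeff, character, intervalIntegral.integral_ofReal, hmean]

/-- Pointwise Agmon inequality on a rectangle `[0, P] × [0, L]` with `L ≤ P`. -/
theorem sq_le_of_periodic_rectangle {P L : ℝ} (hL : 0 < L) (hLP : L ≤ P) {f : ℝ × ℝ → ℝ}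
    (hf : ContDiff ℝ (⊤ : ℕ∞) f) (h1 : ∀ x y, f (x + P, y) = f (x, y))
    (h2 : ∀ x y, f (x, y + L) = f (x, y))
    (hmean : ∫ p in Set.Icc (0 : ℝ) P ×ˢ Set.Icc (0 : ℝ) L, f p = 0) (p : ℝ × ℝ) :
    |f p| ^ 2 ≤ P / L / π *
      √(∫ p in Set.Icc (0 : ℝ) P ×ˢ Set.Icc (0 : ℝ) L, f p ^ 2) *
      √(∫ p in Set.Icc (0 : ℝ) P ×ˢ Set.Icc (0 : ℝ) L, lap f p ^ 2) := by
  have hP : 0 < P := hL.trans_le hLP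
  have hlapc := continuous_lap hf
  have hfc := hf.continuous
  rw [setIntegral_rectangle (f := fun p => f p ^ 2) (by fun_prop) hP.le hL.le,
    setIntegral_rectangle (f := fun p => lap f p ^ 2) (by fun_prop) hP.le hL.le]
  obtain ⟨hsumf, hbound⟩ := rectCoeff_properties hP hL hfc h1 h2
  obtain ⟨hsuml, -⟩ := rectCoeff_properties hP hL hlapc
    (fun x y => by simpa using lap_add_period (a := P) (b := 0) (by simpa using h1) x y)
    (fun x y => by simpa using lap_add_period (a := 0) (b := L) (by simpa using h2) x y)
  set I₀ := ∫ x in 0..P, ∫ y in 0..L, f (x, y) ^ 2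
  set I₂ := ∫ x in 0..P, ∫ y in 0..L, lap f (x, y) ^ 2
  set a : (Fin 2 → ℤ) → ℝ := fun k => ‖(P * L)⁻¹ • rectCoeff P L k f‖ with ha
  set lam : (Fin 2 → ℤ) → ℝ := fun k => (k 0 : ℝ) ^ 2 + (P / L) ^ 2 * (k 1 : ℝ) ^ 2 with hlam
  have hlam0 : ∀ k, 0 ≤ lam k := fun k => by positivity
  have ha0 : a 0 = 0 := by simp [ha, rectCoeff_zero hP.le hL.le hfc hmean]
  have hlap : ∀ k, ‖(P * L)⁻¹ • rectCoeff P L k (lap f)‖ = (2 * π / P) ^ 2 * (lam k * a k) := by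
    intro k
    simp only [ha]
    rw [rectCoeff_lap k hP hL hf h1 h2, norm_smul, norm_smul, norm_mul, Complex.norm_real,
      norm_neg, Real.norm_of_nonneg (mul_nonneg (sq_nonneg _) (hlam0 k))]
    ring
  have hsuml' : HasSum (fun k => (lam k * a k) ^ 2)
      ((((2 * π / P) ^ 2) ^ 2)⁻¹ * ((P * L)⁻¹ * I₂)) := by
    refine (hsuml.mul_left (((2 * π / P) ^ 2) ^ 2)⁻¹).congr_fun fun k => ?_
    rw [hlap k, mul_pow (_ ^ 2) (lam k * a k), inv_mul_cancel_left₀ (by positivity)]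
  set R := P / L / π * √I₀ * √I₂ with hR
  have hfin : ∀ F : Finset (Fin 2 → ℤ), ∑ k ∈ F, a k ≤ √R := by
    intro F
    apply Real.le_sqrt_of_sq_le
    rw [← Finset.sum_erase F ha0]
    refine (sum_sq_le_of_lattice (lam := lam) (fun k => ?_) (F.erase 0) (by simp)
      (sum_le_hasSum _ (fun k _ => sq_nonneg _) hsumf)
      (sum_le_hasSum _ (fun k _ => sq_nonneg _) hsuml')).trans_eq ?_
    · have : 1 ≤ P / L := (one_le_div hL).mpr hLP
      have : 1 ≤ (P / L) ^ 2 := one_le_pow₀ this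
      simp only [hlam]
      nlinarith [sq_nonneg (k 1 : ℝ)]
    · have hinv : √(((2 * π / P) ^ 2) ^ 2)⁻¹ = ((2 * π / P) ^ 2)⁻¹ := by
        rw [Real.sqrt_inv, Real.sqrt_sq (by positivity)]
      rw [Real.sqrt_mul (by positivity), Real.sqrt_mul (by positivity),
        Real.sqrt_mul (by positivity), hinv, hR]
      have hs : √(P * L)⁻¹ * √(P * L)⁻¹ = (P * L)⁻¹ := Real.mul_self_sqrt (by positivity)
      calc _ = 4 * π * (√(P * L)⁻¹ * √(P * L)⁻¹) * ((2 * π / P) ^ 2)⁻¹ * √I₀ * √I₂ := by ring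
        _ = _ := by
          rw [hs]
          congr 2
          field_simp
          ring
  have hsum : Summable a := summable_of_sum_le (fun k => norm_nonneg _) hfin
  have hle : |f p| ≤ √R := (hbound hsum p).trans (hsum.tsum_le_of_sum_le hfin)
  calc |f p| ^ 2 ≤ √R ^ 2 := pow_le_pow_left₀ (abs_nonneg _) hle 2
    _ = R := Real.sq_sqrt (by positivity)

/-- Agmon inequality on the rectangular torus `Ω = [0, L/γ] × [0, L]` of aspect
ratio `γ ≤ 1` with `1/γ` a positive integer:
`‖φ‖_∞² ≤ (1/(γπ)) ‖φ‖ ‖Δφ‖`, i.e. `c_AT(γ) ≤ 1/√(γπ)`. -/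
theorem agmon_rectangular_torus
    (γ L : ℝ) (hγ0 : 0 < γ) (hγ1 : γ ≤ 1) (hL : 0 < L)
    (m : ℕ) (hm : 0 < m) (hγm : 1 / γ = (m : ℝ))
    (φ : ℝ × ℝ → ℝ)
    (hsmooth : ContDiff ℝ (⊤ : ℕ∞) φ)
    (hper1 : ∀ p : ℝ × ℝ, φ (p.1 + L / γ, p.2) = φ p)
    (hper2 : ∀ p : ℝ × ℝ, φ (p.1, p.2 + L) = φ p)
    (hmean : (∫ p in Set.Icc (0 : ℝ) (L / γ) ×ˢ Set.Icc (0 : ℝ) L, φ p) = 0) :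
    (⨆ p ∈ Set.Icc (0 : ℝ) (L / γ) ×ˢ Set.Icc (0 : ℝ) L, |φ p|) ^ 2 ≤
      (1 / (γ * π)) *
        Real.sqrt (∫ p in Set.Icc (0 : ℝ) (L / γ) ×ˢ Set.Icc (0 : ℝ) L, (φ p) ^ 2) *
        Real.sqrt (∫ p in Set.Icc (0 : ℝ) (L / γ) ×ˢ Set.Icc (0 : ℝ) L, (lap φ p) ^ 2) := by
  have hP : L / γ / L = 1 / γ := by field_simp
  have hLP : L ≤ L / γ := by rw [le_div_iff₀ hγ0]; nlinarith
  have key : ∀ p, |φ p| ≤ √(_) := fun p => Real.le_sqrt_of_sq_le <|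
    sq_le_of_periodic_rectangle hL hLP hsmooth (fun x y => hper1 (x, y))
      (fun x y => hper2 (x, y)) hmean p
  rw [hP, div_div] at key
  refine (Real.le_sqrt ?_ (by positivity)).mp ?_
  · exact Real.iSup_nonneg fun p => Real.iSup_nonneg fun _ => abs_nonneg _
  · exact Real.iSup_le (fun p => Real.iSup_le (fun _ => key p) (Real.sqrt_nonneg _))
      (Real.sqrt_nonneg _)
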